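/- Let G be an infinite finitely generated abelian group isomorphic to ℤ^(m) ⊕ ℤ_{n_1} ⊕ … ⊕ ℤ_{n_k}, where m ≥ 1, each n_i ≥ 2, and n_{i+1} divides n_i for all 1 ≤ i ≤ k−1. Then G is N_{2,1}-capable if and only if m ≥ 2. -/

import Mathlib

/-- The commutator `[a,b] = a⁻¹ * b⁻¹ * a * b`. -/
def pcomm {E : Type} [Group E] (a b : E) : E := a⁻¹ * b⁻¹ * a * b

/-- The word `v(x₁,…,x₆) = [[[x₁,x₂],x₃],[[x₄,x₅],x₆]]` defining the polynilpotent
variety `N_{2,1}`. -/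
def n21W {E : Type} [Group E] (g : Fin 6 → E) : E :=
  pcomm (pcomm (pcomm (g 0) (g 1)) (g 2)) (pcomm (pcomm (g 3) (g 4)) (g 5))

/-- The marginal set of a group `E` with respect to the variety `N_{2,1}`: all `a ∈ E`
such that for all `g₁,…,g₆ ∈ E` and every index `i`, replacing `gᵢ` by `gᵢ * a`
leaves the value of `v` unchanged. -/
def n21MarginalSet (E : Type) [Group E] : Set E :=
  {a : E | ∀ (g : Fin 6 → E) (i : Fin 6),
    n21W (Function.update g i (g i * a)) = n21W g}

/-- `G` is `N_{2,1}`-capable if `G ≅ E / V*(E)` for some group `E`, where `V*(E)` is the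
marginal (normal) subgroup of `E` with respect to the variety `N_{2,1}`, i.e. the normal
subgroup whose underlying set is `n21MarginalSet E`. -/
def IsN21Capable (G : Type) [Group G] : Prop :=
  ∃ (E : Type) (_ : Group E) (H : Subgroup E) (_ : H.Normal),
    (H : Set E) = n21MarginalSet E ∧ Nonempty (G ≃* E ⧸ H)

open scoped commutatorElement

/-! ### Capable direction -/

theorem map_pcomm {E E' : Type} [Group E] [Group E'] (f : E →* E') (a b : E) :
    f (pcomm a b) = pcomm (f a) (f b) := by
  simp [pcomm]

theorem map_n21W {E E' : Type} [Group E] [Group E'] (f : E →* E') (g : Fin 6 → E) :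
    f (n21W g) = n21W (fun i => f (g i)) := by
  simp [n21W, map_pcomm]

theorem map_update6 {E E' : Type} [Group E] [Group E'] (f : E →* E') (g : Fin 6 → E)
    (i : Fin 6) (a : E) :
    (fun j => f (Function.update g i (g i * a) j)) =
      Function.update (fun j => f (g j)) i (f (g i) * f a) := by
  funext j
  by_cases h : j = i
  · subst h; simp
  · simp [h]

theorem marginal_map {E E' : Type} [Group E] [Group E'] (f : E →* E')
    (hf : Function.Surjective f) {a : E} (ha : a ∈ n21MarginalSet E) :
    f a ∈ n21MarginalSet E' := by
  intro g i
  choose s hs using hf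
  have h := congrArg f (ha (fun j => s (g j)) i)
  rw [map_n21W, map_n21W, map_update6] at h
  simpa [hs] using h

/-- A class three group over the ring `R` whose abelian quotient is of interest. -/
@[ext] structure NGrp (R : Type) where
  p : R
  q : R
  d : R
  e : R
  c : R
  f : R
  g : R

namespace NGrp
variable {R : Type} [CommRing R]

instance : Mul (NGrp R) := ⟨fun x y =>
  ⟨x.p + y.p, x.q + y.q, x.d + y.d + x.p * y.q, x.e + y.e + x.q * y.q, x.c + y.c + x.p * y.p,
   x.f + y.f + x.p * y.e + x.d * y.q, x.g + y.g + x.p * y.d + x.c * y.q⟩⟩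
instance : One (NGrp R) := ⟨⟨0, 0, 0, 0, 0, 0, 0⟩⟩
instance : Inv (NGrp R) := ⟨fun x =>
  ⟨-x.p, -x.q, -x.d + x.p * x.q, -x.e + x.q * x.q, -x.c + x.p * x.p,
   -x.f + x.p * x.e + x.d * x.q - x.p * x.q * x.q,
   -x.g + x.p * x.d + x.c * x.q - x.p * x.p * x.q⟩⟩

theorem mul_def (x y : NGrp R) : x * y =
  ⟨x.p + y.p, x.q + y.q, x.d + y.d + x.p * y.q, x.e + y.e + x.q * y.q, x.c + y.c + x.p * y.p,
   x.f + y.f + x.p * y.e + x.d * y.q, x.g + y.g + x.p * y.d + x.c * y.q⟩ := rfl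
theorem one_def : (1 : NGrp R) = ⟨0, 0, 0, 0, 0, 0, 0⟩ := rfl
theorem inv_def (x : NGrp R) : x⁻¹ =
  ⟨-x.p, -x.q, -x.d + x.p * x.q, -x.e + x.q * x.q, -x.c + x.p * x.p,
   -x.f + x.p * x.e + x.d * x.q - x.p * x.q * x.q,
   -x.g + x.p * x.d + x.c * x.q - x.p * x.p * x.q⟩ := rfl

instance : Group (NGrp R) := Group.ofLeftAxioms
  (by intro x y z; simp only [mul_def]; ext <;> simp only <;> ring)
  (by intro x; simp only [mul_def, one_def]; ext <;> simp only <;> ring)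
  (by intro x; simp only [mul_def, one_def, inv_def]; ext <;> simp only <;> ring)

/-- The central part. -/
def L (R : Type) [CommRing R] : Subgroup (NGrp R) where
  carrier := {x | x.p = 0 ∧ x.q = 0 ∧ x.d = 0 ∧ x.e = 0 ∧ x.c = 0}
  mul_mem' := by
    rintro x y ⟨h1, h2, h3, h4, h5⟩ ⟨k1, k2, k3, k4, k5⟩
    simp [mul_def, *]
  one_mem' := by simp [one_def]
  inv_mem' := by
    rintro x ⟨h1, h2, h3, h4, h5⟩
    simp [inv_def, *]

theorem mem_L (x : NGrp R) : x ∈ L R ↔ x.p = 0 ∧ x.q = 0 ∧ x.d = 0 ∧ x.e = 0 ∧ x.c = 0 :=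
  Iff.rfl

theorem conj_L (x l : NGrp R) (hl : l ∈ L R) : x * l * x⁻¹ = l := by
  obtain ⟨h1, h2, h3, h4, h5⟩ := hl
  rw [mul_inv_eq_iff_eq_mul]
  ext <;> simp [mul_def, *] <;> ring

theorem pcomm3 (x y z : NGrp R) : pcomm (pcomm x y) z =
    ⟨0, 0, 0, 0, 0, (x.p * y.q - y.p * x.q) * z.q, -((x.p * y.q - y.p * x.q) * z.p)⟩ := by
  simp only [pcomm, mul_def, inv_def]
  ext <;> simp only <;> ring

/-- The abelianization. -/
def ab (R : Type) [CommRing R] : NGrp R →* Multiplicative (R × R) where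
  toFun x := Multiplicative.ofAdd (x.p, x.q)
  map_one' := rfl
  map_mul' _ _ := rfl

end NGrp

/-- Heisenberg group. -/
@[ext] structure HGrp (R : Type) where
  s : R
  t : R
  w : R

namespace HGrp
variable {R : Type} [CommRing R]

instance : Mul (HGrp R) := ⟨fun x y => ⟨x.s + y.s, x.t + y.t, x.w + y.w + x.s * y.t⟩⟩
instance : One (HGrp R) := ⟨⟨0, 0, 0⟩⟩
instance : Inv (HGrp R) := ⟨fun x => ⟨-x.s, -x.t, -x.w + x.s * x.t⟩⟩

theorem mul_def (x y : HGrp R) : x * y = ⟨x.s + y.s, x.t + y.t, x.w + y.w + x.s * y.t⟩ := rfl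
theorem one_def : (1 : HGrp R) = ⟨0, 0, 0⟩ := rfl
theorem inv_def (x : HGrp R) : x⁻¹ = ⟨-x.s, -x.t, -x.w + x.s * x.t⟩ := rfl

instance : Group (HGrp R) := Group.ofLeftAxioms
  (by intro x y z; simp only [mul_def]; ext <;> simp only <;> ring)
  (by intro x; simp only [mul_def, one_def]; ext <;> simp only <;> ring)
  (by intro x; simp only [mul_def, one_def, inv_def]; ext <;> simp only <;> ring)

theorem pcomm_eq (x y : HGrp R) : pcomm x y = ⟨0, 0, x.s * y.t - y.s * x.t⟩ := by
  simp only [pcomm, mul_def, inv_def]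
  ext <;> simp only <;> ring

theorem commutatorElement_eq (x y : HGrp R) : ⁅x, y⁆ = ⟨0, 0, x.s * y.t - y.s * x.t⟩ := by
  simp only [commutatorElement_def, mul_def, inv_def]
  ext <;> simp only <;> ring

/-- The abelianization. -/
def ab (R : Type) [CommRing R] : HGrp R →* Multiplicative (R × R) where
  toFun x := Multiplicative.ofAdd (x.s, x.t)
  map_one' := rfl
  map_mul' _ _ := rfl

end HGrp

section construction
variable (R : Type) [CommRing R]

/-- The presentation map. -/
noncomputable def rhoHom : FreeGroup (NGrp R) →* NGrp R := FreeGroup.lift id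

theorem rhoHom_surj : Function.Surjective (rhoHom R) := fun x => ⟨FreeGroup.of x, by simp [rhoHom]⟩

/-- The preimage of the central part. -/
noncomputable def KSub : Subgroup (FreeGroup (NGrp R)) := (NGrp.L R).comap (rhoHom R)

instance KSub_normal : (KSub R).Normal := by
  constructor
  intro k hk g
  have h : rhoHom R k ∈ NGrp.L R := hk
  change rhoHom R (g * k * g⁻¹) ∈ NGrp.L R
  rw [map_mul, map_mul, map_inv, NGrp.conj_L _ _ h]
  exact h

/-- The projection to the central part. -/
noncomputable def lamHom : KSub R →* Multiplicative (R × R) where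
  toFun k := Multiplicative.ofAdd ((rhoHom R k).f, (rhoHom R k).g)
  map_one' := by simp [NGrp.one_def]
  map_mul' x y := by
    obtain ⟨h1, h2, h3, h4, h5⟩ := x.2
    obtain ⟨k1, k2, k3, k4, k5⟩ := y.2
    rw [← ofAdd_add]
    simp [NGrp.mul_def, *]

theorem exists_theta : ∃ θ : KSub R →* HGrp R, (HGrp.ab R).comp θ = lamHom R := by
  have : IsFreeGroup (KSub R) := inferInstance
  refine ⟨IsFreeGroup.lift (fun x =>
    ⟨(lamHom R (IsFreeGroup.of x)).toAdd.1, (lamHom R (IsFreeGroup.of x)).toAdd.2, 0⟩), ?_⟩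
  apply IsFreeGroup.ext_hom
  intro x
  simp only [MonoidHom.comp_apply, IsFreeGroup.lift_of]
  rfl

theorem conj_theta (θ : KSub R →* HGrp R) (hθ : (HGrp.ab R).comp θ = lamHom R)
    (g : FreeGroup (NGrp R)) (k : KSub R) (hk : k ∈ commutator (KSub R)) :
    θ (MulAut.conjNormal g k) = θ k := by
  have key : commutator (KSub R) ≤
      (θ.comp (MulAut.conjNormal g : MulAut (KSub R)).toMonoidHom).eqLocus θ := by
    rw [commutator_def, Subgroup.commutator_le]
    intro a _ b _
    have hst : ∀ a : KSub R, (θ (MulAut.conjNormal g a)).s = (θ a).s ∧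
        (θ (MulAut.conjNormal g a)).t = (θ a).t := by
      intro a
      have h1 := DFunLike.congr_fun hθ a
      have h2 := DFunLike.congr_fun hθ (MulAut.conjNormal g a)
      have h3 : lamHom R (MulAut.conjNormal g a) = lamHom R a := by
        have : rhoHom R (MulAut.conjNormal g a : KSub R) = rhoHom R a := by
          rw [MulAut.conjNormal_apply, map_mul, map_mul, map_inv, NGrp.conj_L _ _ a.2]
        simp only [lamHom, MonoidHom.coe_mk, OneHom.coe_mk, this]
      have h4 := h2.trans (h3.trans h1.symm)
      have h5 := congrArg Multiplicative.toAdd h4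
      exact ⟨congrArg Prod.fst h5, congrArg Prod.snd h5⟩
    change θ (MulAut.conjNormal g ⁅a, b⁆) = θ ⁅a, b⁆
    rw [map_commutatorElement, map_commutatorElement, map_commutatorElement,
      HGrp.commutatorElement_eq, HGrp.commutatorElement_eq,
      (hst a).1, (hst a).2, (hst b).1, (hst b).2]
  exact key hk

/-- The determinant of two vectors. -/
def det2 (x y : Multiplicative (R × R)) : R :=
  x.toAdd.1 * y.toAdd.2 - y.toAdd.1 * x.toAdd.2

theorem exists_good : ∃ (E : Type) (_ : Group E) (π : E →* Multiplicative (R × R)),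
    Function.Surjective π ∧ ∀ g g' : Fin 6 → E, n21W g = n21W g' ↔
      det2 R (π (g 0)) (π (g 1)) * det2 R (π (g 3)) (π (g 4)) * det2 R (π (g 2)) (π (g 5)) =
      det2 R (π (g' 0)) (π (g' 1)) * det2 R (π (g' 3)) (π (g' 4)) *
        det2 R (π (g' 2)) (π (g' 5)) := by
  obtain ⟨θ, hθ⟩ := exists_theta R
  let S : Subgroup (FreeGroup (NGrp R)) := (θ.ker ⊓ commutator (KSub R)).map (KSub R).subtype
  have hSn : S.Normal := by
    constructor
    rintro _ ⟨k, ⟨hk1, hk2⟩, rfl⟩ g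
    refine ⟨MulAut.conjNormal g k, ⟨?_, ?_⟩, ?_⟩
    · have h1 : θ k = 1 := hk1
      change θ (MulAut.conjNormal g k) = 1
      rw [conj_theta R θ hθ g k hk2, h1]
    · have := (Subgroup.characteristic_iff_map_le.mp
        (inferInstance : (commutator (KSub R)).Characteristic)) (MulAut.conjNormal g)
      exact this ⟨k, hk2, rfl⟩
    · simp
  let π0 : FreeGroup (NGrp R) →* Multiplicative (R × R) := (NGrp.ab R).comp (rhoHom R)
  have hπ0 : S ≤ π0.ker := by
    rintro _ ⟨k, ⟨hk1, hk2⟩, rfl⟩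
    obtain ⟨h1, h2, -⟩ := k.2
    change Multiplicative.ofAdd ((rhoHom R k).p, (rhoHom R k).q) = 1
    rw [h1, h2]; rfl
  refine ⟨FreeGroup (NGrp R) ⧸ S, inferInstance, QuotientGroup.lift S π0 hπ0, ?_, ?_⟩
  · intro x
    obtain ⟨y, hy⟩ := rhoHom_surj R ⟨x.toAdd.1, x.toAdd.2, 0, 0, 0, 0, 0⟩
    refine ⟨QuotientGroup.mk y, ?_⟩
    change NGrp.ab R (rhoHom R y) = x
    rw [hy]; rfl
  · intro g g'
    obtain ⟨s, rfl⟩ : ∃ s : Fin 6 → FreeGroup (NGrp R), (fun i => QuotientGroup.mk' S (s i)) = g := by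
      choose s hs using QuotientGroup.mk'_surjective S
      exact ⟨fun i => s (g i), funext fun i => hs _⟩
    obtain ⟨s', rfl⟩ : ∃ s : Fin 6 → FreeGroup (NGrp R), (fun i => QuotientGroup.mk' S (s i)) = g' := by
      choose s hs using QuotientGroup.mk'_surjective S
      exact ⟨fun i => s (g' i), funext fun i => hs _⟩
    rw [← map_n21W, ← map_n21W]
    have hK : ∀ x y z : FreeGroup (NGrp R), pcomm (pcomm x y) z ∈ KSub R := by
      intro x y z
      change rhoHom R _ ∈ NGrp.L R
      rw [map_pcomm, map_pcomm, NGrp.pcomm3]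
      simp [NGrp.mem_L]
    have hW : ∀ s : Fin 6 → FreeGroup (NGrp R), ∃ k ∈ commutator (KSub R),
        (k : FreeGroup (NGrp R)) = n21W s ∧ θ k = ⟨0, 0,
          det2 R (π0 (s 0)) (π0 (s 1)) * det2 R (π0 (s 3)) (π0 (s 4)) *
            det2 R (π0 (s 2)) (π0 (s 5))⟩ := by
      intro s
      refine ⟨pcomm ⟨_, hK (s 0) (s 1) (s 2)⟩ ⟨_, hK (s 3) (s 4) (s 5)⟩, ?_, ?_, ?_⟩
      · have : ∀ a b : KSub R, pcomm a b ∈ commutator (KSub R) := by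
          intro a b
          have h := Subgroup.commutator_mem_commutator (Subgroup.mem_top a⁻¹)
            (Subgroup.mem_top b⁻¹)
          rw [commutatorElement_def, inv_inv, inv_inv] at h
          exact h
        exact this _ _
      · rfl
      · have hst : ∀ x y z, (θ ⟨_, hK x y z⟩).s = det2 R (π0 x) (π0 y) * (π0 z).toAdd.2 ∧
            (θ ⟨_, hK x y z⟩).t = -(det2 R (π0 x) (π0 y) * (π0 z).toAdd.1) := by
          intro x y z
          have h1 := congrArg Multiplicative.toAdd (DFunLike.congr_fun hθ ⟨_, hK x y z⟩)
          have h2 := NGrp.pcomm3 (rhoHom R x) (rhoHom R y) (rhoHom R z)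
          rw [← map_pcomm, ← map_pcomm] at h2
          have h3 := congrArg Prod.fst h1
          have h4 := congrArg Prod.snd h1
          refine ⟨h3.trans ?_, h4.trans ?_⟩
          · change (rhoHom R (pcomm (pcomm x y) z)).f = _
            rw [h2]; rfl
          · change (rhoHom R (pcomm (pcomm x y) z)).g = _
            rw [h2]; rfl
        rw [map_pcomm, HGrp.pcomm_eq, (hst _ _ _).1, (hst _ _ _).1, (hst _ _ _).2, (hst _ _ _).2]
        ext <;> simp only [det2]
        ring
    obtain ⟨k, hk, hk1, hk2⟩ := hW s
    obtain ⟨k', hk', hk1', hk2'⟩ := hW s'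
    have hS : QuotientGroup.mk' S (n21W s) = QuotientGroup.mk' S (n21W s') ↔ θ k = θ k' := by
      rw [QuotientGroup.mk'_apply, QuotientGroup.mk'_apply, QuotientGroup.eq, ← hk1, ← hk1']
      constructor
      · rintro ⟨l, ⟨hl, -⟩, h⟩
        have : l = k⁻¹ * k' := Subtype.ext h
        subst this
        have h' : θ (k⁻¹ * k') = 1 := hl
        rw [map_mul, map_inv, inv_mul_eq_one] at h'
        exact h'
      · intro h
        refine ⟨k⁻¹ * k', ⟨?_, (commutator (KSub R)).mul_mem ((commutator (KSub R)).inv_mem hk) hk'⟩, rfl⟩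
        change θ (k⁻¹ * k') = 1
        rw [map_mul, map_inv, inv_mul_eq_one, h]
    rw [hS, hk2, hk2', HGrp.mk.injEq]
    simp only [true_and]
    rfl

theorem exists_good' : ∃ (E : Type) (_ : Group E) (π : E →* Multiplicative (R × R)),
    Function.Surjective π ∧ ∀ a : E, a ∈ n21MarginalSet E ↔ π a = 1 := by
  obtain ⟨E, _, π, hπ, h⟩ := exists_good R
  refine ⟨E, _, π, hπ, fun a => ⟨fun ha => ?_, fun ha g i => ?_⟩⟩
  · have key : ∀ x : Multiplicative (R × R), det2 R (π a) x = 0 := by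
      intro x
      obtain ⟨y, rfl⟩ := hπ x
      obtain ⟨u, hu⟩ := hπ (Multiplicative.ofAdd (1, 0))
      obtain ⟨v, hv⟩ := hπ (Multiplicative.ofAdd (0, 1))
      have h1 := (h _ _).1 (ha ![1, y, u, u, v, v] 0)
      simpa [det2, hu, hv, Function.update] using h1
    have h1 := key (Multiplicative.ofAdd (0, 1))
    have h2 := key (Multiplicative.ofAdd (1, 0))
    simp [det2] at h1 h2
    exact Multiplicative.toAdd.injective (Prod.ext h1 h2)
  · rw [h]
    have : ∀ j, π (Function.update g i (g i * a) j) = π (g j) := by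
      intro j
      by_cases hj : j = i
      · subst hj; simp [ha]
      · simp [hj]
    simp only [this]

end construction

theorem pcomm_comm {A : Type} [CommGroup A] (a b : A) : pcomm a b = 1 := by
  simp [pcomm, mul_comm]

theorem capable_of_sub (A : Type) [CommGroup A]
    (hA : ∀ a : A, a ≠ 1 → ∃ (n : ℕ) (φ : A →* Multiplicative (ZMod n × ZMod n)),
      Function.Surjective φ ∧ φ a ≠ 1) : IsN21Capable A := by
  have hA' : ∀ j : {a : A // a ≠ 1}, ∃ (n : ℕ) (φ : A →* Multiplicative (ZMod n × ZMod n)),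
      Function.Surjective φ ∧ φ j.1 ≠ 1 := fun j => hA j.1 j.2
  choose n φ hφ hφ1 using hA'
  choose E iE π hπ hm using fun j => exists_good' (ZMod (n j))
  let P : Subgroup (A × ((j : {a : A // a ≠ 1}) → E j)) :=
    { carrier := {x | ∀ j, φ j x.1 = π j (x.2 j)}
      mul_mem' := by intro x y hx hy j; simp [hx j, hy j]
      one_mem' := by intro j; simp
      inv_mem' := by intro x hx j; simp [hx j] }
  have hP : ∀ x : P, ∀ j, φ j x.1.1 = π j (x.1.2 j) := fun x => x.2
  choose t ht using hπ
  let f : P →* A := (MonoidHom.fst _ _).comp P.subtype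
  let pr : ∀ j, P →* E j := fun j =>
    (Pi.evalMonoidHom E j).comp ((MonoidHom.snd _ _).comp P.subtype)
  have hf : Function.Surjective f := by
    intro a
    exact ⟨⟨(a, fun j => t j (φ j a)), fun j => (ht j _).symm⟩, rfl⟩
  have hpr : ∀ j, Function.Surjective (pr j) := by
    intro j e
    obtain ⟨a, ha⟩ := hφ j (π j e)
    classical
    refine ⟨⟨(a, Function.update (fun j => t j (φ j a)) j e), fun i => ?_⟩, ?_⟩
    · by_cases h : i = j
      · subst h; simp [ha]
      · simp [h, ht]
    · simp [pr]
  refine ⟨P, inferInstance, f.ker, inferInstance, ?_,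
    ⟨(QuotientGroup.quotientKerEquivOfSurjective f hf).symm⟩⟩
  ext x
  constructor
  · intro hx g i
    have hx : x.1.1 = 1 := hx
    apply Subtype.ext
    apply Prod.ext
    · change f (n21W (Function.update g i (g i * x))) = f (n21W g)
      rw [map_n21W, map_n21W, n21W, n21W, pcomm_comm, pcomm_comm (pcomm _ _)]
    · funext j
      change pr j (n21W (Function.update g i (g i * x))) = pr j (n21W g)
      rw [map_n21W, map_n21W, map_update6]
      apply (hm j (pr j x)).2
      have := hP x j
      rw [hx, map_one] at this
      exact this.symm
  · intro hx
    change x.1.1 = 1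
    by_contra hne
    apply hφ1 ⟨_, hne⟩
    rw [hP x]
    exact (hm _ _).1 (marginal_map (pr _) (hpr _) hx)

theorem capable_congr {G A : Type} [Group G] [Group A] (e : G ≃* A) (h : IsN21Capable A) :
    IsN21Capable G := by
  obtain ⟨E, i, H, hn, h1, ⟨h2⟩⟩ := h
  exact ⟨E, i, H, hn, h1, ⟨e.trans h2⟩⟩

theorem capable_two_le (m k : ℕ) (n : Fin k → ℕ) (hm : 2 ≤ m) :
    IsN21Capable (Multiplicative ((Fin m → ℤ) × ((i : Fin k) → ZMod (n i)))) := by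
  apply capable_of_sub
  intro a ha
  by_cases h : ∃ i, a.toAdd.1 i ≠ 0
  · obtain ⟨i, hi⟩ := h
    obtain ⟨i', hi'⟩ : ∃ i' : Fin m, i' ≠ i := by
      have : Nontrivial (Fin m) := Fin.nontrivial_iff_two_le.mpr hm
      exact exists_ne i
    let ψ : ((Fin m → ℤ) × ((i : Fin k) → ZMod (n i))) →+ ZMod 0 × ZMod 0 :=
      { toFun := fun x => (x.1 i, x.1 i')
        map_zero' := rfl
        map_add' := fun _ _ => rfl }
    refine ⟨0, AddMonoidHom.toMultiplicative ψ, ?_, ?_⟩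
    · intro y
      obtain ⟨y1, y2⟩ := y
      have hz : ∀ z1 z2 : ℤ, ∃ v : Fin m → ℤ, v i = z1 ∧ v i' = z2 := fun z1 z2 =>
        ⟨fun j => if j = i then z1 else z2, by simp, by simp [hi']⟩
      obtain ⟨v, hv1, hv2⟩ := hz y1 y2
      exact ⟨Multiplicative.ofAdd (v, 0), Prod.ext hv1 hv2⟩
    · intro h1
      exact hi (congrArg Prod.fst (congrArg Multiplicative.toAdd h1))
  · push Not at h
    obtain ⟨i, hi⟩ : ∃ i, a.toAdd.2 i ≠ 0 := by
      by_contra h2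
      push Not at h2
      exact ha (Multiplicative.toAdd.injective (Prod.ext (funext h) (funext h2)))
    let i0 : Fin m := ⟨0, by omega⟩
    let i1 : Fin m := ⟨1, by omega⟩
    have h01 : i1 ≠ i0 := by simp [i0, i1]
    let ψ : ((Fin m → ℤ) × ((i : Fin k) → ZMod (n i))) →+ ZMod (n i) × ZMod (n i) :=
      { toFun := fun x => ((x.1 i0 : ZMod (n i)) + x.2 i, (x.1 i1 : ZMod (n i)))
        map_zero' := by simp
        map_add' := fun x y => by ext <;> simp; ring }
    refine ⟨n i, AddMonoidHom.toMultiplicative ψ, ?_, ?_⟩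
    · intro y
      obtain ⟨y1, y2⟩ := y
      obtain ⟨z1, rfl⟩ := ZMod.intCast_surjective y1
      obtain ⟨z2, rfl⟩ := ZMod.intCast_surjective y2
      refine ⟨Multiplicative.ofAdd (fun j => if j = i0 then z1 else z2, 0), ?_⟩
      change ψ (fun j => if j = i0 then z1 else z2, 0) = _
      simp [ψ, h01]
    · intro h1
      have h2 : ψ a.toAdd = 0 := h1
      have h3 := congrArg Prod.fst h2
      simp [ψ, h i0] at h3
      exact hi h3

/-! ### Non-capable direction -/

/-- The triple commutator. -/
def tcomm {Q : Type} [Group Q] (x y z : Q) : Q := pcomm (pcomm x y) z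

theorem map_tcomm {E E' : Type} [Group E] [Group E'] (f : E →* E') (a b c : E) :
    f (tcomm a b c) = tcomm (f a) (f b) (f c) := by
  simp [tcomm, map_pcomm]

theorem pcomm_mul_left {Q : Type} [Group Q] (a b z : Q) :
    pcomm (a * b) z = b⁻¹ * pcomm a z * b * pcomm b z := by
  simp only [pcomm]; group

theorem pcomm_mul_right {Q : Type} [Group Q] (p z w : Q) :
    pcomm p (z * w) = pcomm p w * (w⁻¹ * pcomm p z * w) := by
  simp only [pcomm]; group

theorem pcomm_mul_left' {Q : Type} [Group Q] (a b z : Q) :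
    pcomm (a * b) z = pcomm a z * tcomm a z b * pcomm b z := by
  simp only [pcomm, tcomm]; group

theorem pcomm_of_comm {Q : Type} [Group Q] {a b : Q} (h : a * b = b * a) : pcomm a b = 1 := by
  rw [pcomm, mul_assoc, h]; group

theorem comm_of_pcomm {Q : Type} [Group Q] {a b : Q} (h : pcomm a b = 1) : a * b = b * a := by
  have : a * b = b * a * pcomm a b := by simp only [pcomm]; group
  rw [this, h, mul_one]

section class3
variable {Q : Type} [Group Q]

theorem tcomm_conj
    (hc : ∀ x y z w : Q, tcomm x y z * w = w * tcomm x y z)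
    (x y z w : Q) : w⁻¹ * tcomm x y z * w = tcomm x y z := by
  rw [mul_assoc, hc, inv_mul_cancel_left]

theorem tcomm_mul_left
    (hc : ∀ x y z w : Q, tcomm x y z * w = w * tcomm x y z)
    (x x' y z : Q) :
    tcomm (x * x') y z = tcomm x y z * tcomm x' y z := by
  have h1 : pcomm (pcomm x y * tcomm x y x') z = tcomm x y z := by
    rw [pcomm_mul_left, pcomm_of_comm (hc x y x' z), mul_one]
    exact tcomm_conj hc x y z _
  rw [tcomm, pcomm_mul_left', pcomm_mul_left, h1, tcomm_conj hc]
  rfl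

theorem tcomm_mul_right
    (hc : ∀ x y z w : Q, tcomm x y z * w = w * tcomm x y z)
    (x y z z' : Q) :
    tcomm x y (z * z') = tcomm x y z * tcomm x y z' := by
  rw [tcomm, pcomm_mul_right]
  change tcomm x y z' * (z'⁻¹ * tcomm x y z * z') = _
  rw [tcomm_conj hc, hc]

theorem tcomm_swap
    (hc : ∀ x y z w : Q, tcomm x y z * w = w * tcomm x y z)
    (x y z : Q) : tcomm x y z = (tcomm y x z)⁻¹ := by
  have h : tcomm x y z = pcomm y x * (tcomm y x z)⁻¹ * (pcomm y x)⁻¹ := by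
    simp only [tcomm, pcomm]; group
  rw [h, mul_inv_eq_iff_eq_mul, eq_inv_mul_iff_mul_eq, ← mul_assoc, hc, mul_assoc, mul_inv_cancel,
    mul_one]

theorem tcomm_mul_mid
    (hc : ∀ x y z w : Q, tcomm x y z * w = w * tcomm x y z)
    (x y y' z : Q) :
    tcomm x (y * y') z = tcomm x y z * tcomm x y' z := by
  rw [tcomm_swap hc, tcomm_mul_left hc, mul_inv_rev, ← tcomm_swap hc, ← tcomm_swap hc, hc]

theorem tcomm_zpow_left
    (hc : ∀ x y z w : Q, tcomm x y z * w = w * tcomm x y z)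
    (x y z : Q) (n : ℤ) : tcomm (x ^ n) y z = tcomm x y z ^ n :=
  map_zpow (MonoidHom.mk' (fun x => tcomm x y z) (fun a b => tcomm_mul_left hc a b y z)) x n

theorem tcomm_zpow_mid
    (hc : ∀ x y z w : Q, tcomm x y z * w = w * tcomm x y z)
    (x y z : Q) (n : ℤ) : tcomm x (y ^ n) z = tcomm x y z ^ n :=
  map_zpow (MonoidHom.mk' (fun y => tcomm x y z) (fun a b => tcomm_mul_mid hc x a b z)) y n

theorem tcomm_zpow_right
    (hc : ∀ x y z w : Q, tcomm x y z * w = w * tcomm x y z)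
    (x y z : Q) (n : ℤ) : tcomm x y (z ^ n) = tcomm x y z ^ n :=
  map_zpow (MonoidHom.mk' (fun z => tcomm x y z) (fun a b => tcomm_mul_right hc x y a b)) z n

theorem tcomm_self (x z : Q) : tcomm x x z = 1 := by
  rw [tcomm, pcomm_of_comm rfl]
  simp [pcomm]

theorem class3_left
    (hc : ∀ x y z w : Q, tcomm x y z * w = w * tcomm x y z)
    (X : Q) (N : ℤ)
    (h : ∀ y : Q, ∃ (j : ℤ) (m : Q), y ^ N = X ^ j * m ∧ (∀ a b, tcomm a m b = 1))
    (y z : Q) : tcomm (X ^ N) y z = 1 := by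
  obtain ⟨j, m, h1, h2⟩ := h y
  rw [tcomm_zpow_left hc, ← tcomm_zpow_mid hc, h1, tcomm_mul_mid hc, h2, tcomm_zpow_mid hc,
    tcomm_self]
  simp

theorem class3_right
    (hc : ∀ x y z w : Q, tcomm x y z * w = w * tcomm x y z)
    (X : Q) (N : ℤ)
    (h : ∀ y : Q, ∃ (j : ℤ) (m : Q), y ^ N = X ^ (N * j) * m ∧ (∀ a b, tcomm a m b = 1))
    (y z : Q) : tcomm y z (X ^ N) = 1 := by
  obtain ⟨j, m, h1, h2⟩ := h z
  have h3 := class3_left hc X N (fun y => ⟨_, (h y).choose_spec⟩) y X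
  rw [tcomm_zpow_right hc, ← tcomm_zpow_mid hc, h1, tcomm_mul_mid hc, h2, zpow_mul,
    tcomm_zpow_mid hc, tcomm_swap hc, h3]
  simp

end class3

theorem pcomm_congr_left {E : Type} [Group E] {u c w : E} (h1 : c * u = u * c)
    (h2 : c * w = w * c) : pcomm (u * c) w = pcomm u w := by
  rw [pcomm_mul_left, pcomm_of_comm h2, mul_one]
  have : pcomm u w * c = c * pcomm u w :=
    ((Commute.inv_left (show Commute u c from h1.symm)).mul_left
      (Commute.inv_left (show Commute w c from h2.symm)) |>.mul_left
      (show Commute u c from h1.symm) |>.mul_left (show Commute w c from h2.symm)).eq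
  rw [mul_assoc, this, inv_mul_cancel_left]

theorem pcomm_inv {E : Type} [Group E] (a b : E) : pcomm a b = (pcomm b a)⁻¹ := by
  simp only [pcomm]; group

theorem not_capable_core {E A : Type} [Group E] [CommGroup A] (π : E →* A)
    (hm : ∀ a, a ∈ n21MarginalSet E ↔ π a = 1) (x : E) (N : ℤ)
    (hx : ∀ y : E, ∃ j : ℤ, π y ^ N = π x ^ (N * j)) : π x ^ N = 1 := by
  let W : Set E := {t | ∃ u v w, t = tcomm u v w}
  let C : Subgroup E := Subgroup.centralizer W
  have hCmem : ∀ c, c ∈ C ↔ ∀ u v w, c * tcomm u v w = tcomm u v w * c := by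
    intro c
    rw [Subgroup.mem_centralizer_iff]
    constructor
    · intro h u v w
      exact (h _ ⟨u, v, w, rfl⟩).symm
    · rintro h _ ⟨u, v, w, rfl⟩
      exact (h u v w).symm
  have hCn : C.Normal := by
    constructor
    intro c hc g
    rw [hCmem] at hc ⊢
    intro u v w
    have h := congrArg (MulAut.conj g)
      (hc (MulAut.conj g⁻¹ u) (MulAut.conj g⁻¹ v) (MulAut.conj g⁻¹ w))
    have h2 : MulAut.conj g (tcomm (MulAut.conj g⁻¹ u) (MulAut.conj g⁻¹ v) (MulAut.conj g⁻¹ w))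
        = tcomm u v w := by
      have := map_tcomm (MulAut.conj g).toMonoidHom (MulAut.conj g⁻¹ u) (MulAut.conj g⁻¹ v)
        (MulAut.conj g⁻¹ w)
      simpa [mul_assoc] using this
    rw [map_mul, map_mul, h2] at h
    exact h
  let q : E →* E ⧸ C := QuotientGroup.mk' C
  have hq : Function.Surjective q := QuotientGroup.mk'_surjective C
  have hq1 : ∀ c, q c = 1 ↔ c ∈ C := fun c => QuotientGroup.eq_one_iff c
  have one1 : ∀ y z : E, tcomm 1 y z = 1 := by intros; simp [tcomm, pcomm]
  have one2 : ∀ y z : E, tcomm y 1 z = 1 := by intros; simp [tcomm, pcomm]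
  have p1 : ∀ y : E, pcomm 1 y = 1 := by intros; simp [pcomm]
  have n1 : ∀ a, π a = 1 → ∀ y z, tcomm (q a) y z = 1 := by
    intro a ha y z
    obtain ⟨y, rfl⟩ := hq y
    obtain ⟨z, rfl⟩ := hq z
    rw [← map_tcomm, hq1, hCmem]
    intro u v w
    apply comm_of_pcomm
    have h : pcomm (tcomm (1 * a) y z) (tcomm u v w) = pcomm (tcomm 1 y z) (tcomm u v w) :=
      (hm a).2 ha ![1, y, z, u, v, w] 0
    rwa [one1, p1, one_mul] at h
  have n2 : ∀ a, π a = 1 → ∀ y z, tcomm y (q a) z = 1 := by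
    intro a ha y z
    obtain ⟨y, rfl⟩ := hq y
    obtain ⟨z, rfl⟩ := hq z
    rw [← map_tcomm, hq1, hCmem]
    intro u v w
    apply comm_of_pcomm
    have h : pcomm (tcomm y (1 * a) z) (tcomm u v w) = pcomm (tcomm y 1 z) (tcomm u v w) :=
      (hm a).2 ha ![y, 1, z, u, v, w] 1
    rwa [one2, p1, one_mul] at h
  have hπp : ∀ a b : E, π (pcomm a b) = 1 := by
    intro a b
    rw [map_pcomm]; simp [pcomm, mul_comm]
  have hc : ∀ x y z w : E ⧸ C, tcomm x y z * w = w * tcomm x y z := by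
    intro x y z w
    obtain ⟨x, rfl⟩ := hq x
    obtain ⟨y, rfl⟩ := hq y
    apply comm_of_pcomm
    have := n1 _ (hπp x y) z w
    rwa [map_pcomm] at this
  have hX : ∀ y : E ⧸ C, ∃ (j : ℤ) (m : E ⧸ C),
      y ^ N = q x ^ (N * j) * m ∧ (∀ a b, tcomm a m b = 1) := by
    intro y
    obtain ⟨y, rfl⟩ := hq y
    obtain ⟨j, hj⟩ := hx y
    refine ⟨j, q ((x ^ (N * j))⁻¹ * y ^ N), ?_, n2 _ ?_⟩
    · simp
    · simp [hj]
  have t1 : ∀ y z, tcomm (q x ^ N) y z = 1 :=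
    class3_left hc (q x) N (fun y => ⟨_, (hX y).choose_spec⟩)
  have t3 : ∀ y z, tcomm y z (q x ^ N) = 1 := class3_right hc (q x) N hX
  have t2 : ∀ y z, tcomm y (q x ^ N) z = 1 := by
    intro y z
    rw [tcomm_swap hc, t1, inv_one]
  rw [← map_zpow, ← hm]
  rw [← map_zpow] at t1 t2 t3
  have e1 : ∀ g y z, q (tcomm (g * x ^ N) y z) = q (tcomm g y z) := by
    intro g y z
    rw [map_tcomm, map_tcomm, map_mul, tcomm_mul_left hc, t1, mul_one]
  have e2 : ∀ g y z, q (tcomm y (g * x ^ N) z) = q (tcomm y g z) := by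
    intro g y z
    rw [map_tcomm, map_tcomm, map_mul, tcomm_mul_mid hc, t2, mul_one]
  have e3 : ∀ g y z, q (tcomm y z (g * x ^ N)) = q (tcomm y z g) := by
    intro g y z
    rw [map_tcomm, map_tcomm, map_mul, tcomm_mul_right hc, t3, mul_one]
  have key : ∀ a b c a' b' c' u v w, q (tcomm a b c) = q (tcomm a' b' c') →
      pcomm (tcomm a b c) (tcomm u v w) = pcomm (tcomm a' b' c') (tcomm u v w) := by
    intro a b c a' b' c' u v w h
    have h1 : (tcomm a' b' c')⁻¹ * tcomm a b c ∈ C := by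
      rw [← hq1, map_mul, map_inv, h, inv_mul_cancel]
    rw [hCmem] at h1
    have := pcomm_congr_left (h1 a' b' c') (h1 u v w)
    rwa [mul_inv_cancel_left] at this
  have key' : ∀ a b c a' b' c' u v w, q (tcomm a b c) = q (tcomm a' b' c') →
      pcomm (tcomm u v w) (tcomm a b c) = pcomm (tcomm u v w) (tcomm a' b' c') := by
    intro a b c a' b' c' u v w h
    rw [pcomm_inv, key _ _ _ _ _ _ _ _ _ h, ← pcomm_inv]
  intro g i
  fin_cases i
  · exact key _ _ _ _ _ _ _ _ _ (e1 (g 0) (g 1) (g 2))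
  · exact key _ _ _ _ _ _ _ _ _ (e2 (g 1) (g 0) (g 2))
  · exact key _ _ _ _ _ _ _ _ _ (e3 (g 2) (g 0) (g 1))
  · exact key' _ _ _ _ _ _ _ _ _ (e1 (g 3) (g 4) (g 5))
  · exact key' _ _ _ _ _ _ _ _ _ (e2 (g 4) (g 3) (g 5))
  · exact key' _ _ _ _ _ _ _ _ _ (e3 (g 5) (g 3) (g 4))

theorem not_capable_one (k : ℕ) (n : Fin k → ℕ) (hn : ∀ i, 2 ≤ n i) :
    ¬ IsN21Capable (Multiplicative ((Fin 1 → ℤ) × ((i : Fin k) → ZMod (n i)))) := by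
  rintro ⟨E, _, H, _, hH, ⟨e⟩⟩
  let π : E →* Multiplicative ((Fin 1 → ℤ) × ((i : Fin k) → ZMod (n i))) :=
    e.symm.toMonoidHom.comp (QuotientGroup.mk' H)
  have hπ : Function.Surjective π := e.symm.surjective.comp (QuotientGroup.mk'_surjective H)
  have hm : ∀ a, a ∈ n21MarginalSet E ↔ π a = 1 := by
    intro a
    rw [← hH]
    change a ∈ H ↔ e.symm (QuotientGroup.mk a) = 1
    rw [map_eq_one_iff e.symm e.symm.injective, QuotientGroup.eq_one_iff]
  obtain ⟨x, hx⟩ := hπ (Multiplicative.ofAdd (1, 0))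
  let N : ℕ := ∏ i, n i
  have hN : N ≠ 0 := Finset.prod_ne_zero_iff.2 fun i _ => by have := hn i; omega
  have h := not_capable_core π hm x N (by
    intro y
    refine ⟨(π y).toAdd.1 0, ?_⟩
    rw [hx]
    apply Multiplicative.toAdd.injective
    rw [toAdd_zpow, toAdd_zpow, toAdd_ofAdd]
    apply Prod.ext
    · funext i
      have : i = 0 := Subsingleton.elim _ _
      subst this
      simp
    · funext i
      have : (N : ZMod (n i)) = 0 := by
        rw [ZMod.natCast_eq_zero_iff]
        exact Finset.dvd_prod_of_mem _ (Finset.mem_univ i)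
      simp [this])
  rw [hx] at h
  have h2 := congrFun (congrArg Prod.fst (congrArg Multiplicative.toAdd h)) 0
  rw [toAdd_zpow, toAdd_ofAdd] at h2
  simp at h2
  exact hN h2

/-- An infinite finitely generated abelian group `ℤ^(m) ⊕ ℤ_{n_1} ⊕ … ⊕ ℤ_{n_k}`
(with `m ≥ 1`, each `n_i ≥ 2`, `n_{i+1} ∣ n_i`) is `N_{2,1}`-capable if and only if
`m ≥ 2`. -/
theorem n21Capable_infinite_fg_abelian_iff (G : Type) [Group G]
    (m k : ℕ) (hm : 1 ≤ m) (n : Fin k → ℕ)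
    (hn : ∀ i : Fin k, 2 ≤ n i)
    (hdvd : ∀ i : Fin k, ∀ h : (i : ℕ) + 1 < k, n ⟨(i : ℕ) + 1, h⟩ ∣ n i)
    (hG : Nonempty (G ≃* Multiplicative ((Fin m → ℤ) × ((i : Fin k) → ZMod (n i))))) :
    IsN21Capable G ↔ 2 ≤ m := by
  obtain ⟨e⟩ := hG
  constructor
  · intro h
    by_contra hlt
    obtain rfl : m = 1 := by omega
    exact not_capable_one k n hn (capable_congr e.symm h)
  · intro h
    exact capable_congr e (capable_two_le m k n h)
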